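/- Let σ : ℝ → ℝ be bounded and differentiable such that its derivative is Lipschitz continuous and bounded, and fix data points (X₁,Y₁),…,(X_n,Y_n) ∈ ℝ^d × ℝ. Let α_n ≥ 1, t_n ≥ L_n > 0, γ*_n ≥ 1, B_n ≥ 1, r ≥ 2d, and let w₁, w₂, v be weight vectors such that max{|(w₁)^{(L)}_{1,1,k}|, |(w₂)^{(L)}_{1,1,k}|} ≤ γ*_n for k = 1,…,K_n, max{|(w₁)^{(l)}_{k,i,j}|, |(w₂)^{(l)}_{k,i,j}|} ≤ B_n for l = 1,…,L−1, and ‖w₂ − v‖² ≤ 8·(t_n/L_n)·max{F_n(v),1}. Then there exists a constant c₇ > 0, depending only on d, r, L, σ and c₂, such that ‖(∇_w F_n)(w₁) − (∇_w F_n)(w₂)‖ ≤ c₇ · max{√(F_n(v)),1} · (γ*_n)² · B_n^{3L} · α_n³ · K_n^{3/2} · √(t_n/L_n) · ‖w₁ − w₂‖. -/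

import Mathlib

open MeasureTheory ProbabilityTheory Filter

noncomputable section

/-- The logistic squasher `σ(x) = 1/(1+e^{-x})`. -/
def sigLog : ℝ → ℝ := fun x => 1 / (1 + Real.exp (-x))

/-- Index type for the weights of a linear combination of `Kn` fully connected deep networks
with `L` layers, `r` neurons per layer and input dimension `d`:
`Sum.inl (k, i, j)` is the level-0 weight `w^{(0)}_{k,i+1,j}` (`j = 0` is the bias,
`j = t+1` multiplies `x^{(t+1)}`); `Sum.inr (Sum.inl (k, m, i, j))` is the inner weight
`w^{(m+1)}_{k,i+1,j}` for the levels `m+1 ∈ {1,…,L-1}` (`j = 0` is the bias, `j = t+1`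
multiplies the output of neuron `t+1`); `Sum.inr (Sum.inr j)` is the output weight
`w^{(L)}_{1,1,j+1}`. -/
abbrev Idx (Kn L r d : ℕ) : Type :=
  (Fin Kn × Fin r × Fin (d + 1)) ⊕ ((Fin Kn × Fin (L - 1) × Fin r × Fin (r + 1)) ⊕ Fin Kn)

/-- `hid σ Kn L r d w k m i x` is the output `f^{(m+1)}_{k,i+1}(x)` of neuron `i+1` in
layer `m+1` of the `k`-th fully connected subnetwork. -/
def hid (σ : ℝ → ℝ) (Kn L r d : ℕ) (w : EuclideanSpace ℝ (Idx Kn L r d)) (k : Fin Kn) :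
    ℕ → Fin r → (Fin d → ℝ) → ℝ
  | 0 => fun i x =>
      σ ((∑ j : Fin d, w (Sum.inl (k, i, j.succ)) * x j) + w (Sum.inl (k, i, 0)))
  | (m + 1) => fun i x =>
      σ ((∑ j : Fin r,
            (if h : m < L - 1 then w (Sum.inr (Sum.inl (k, ⟨m, h⟩, i, j.succ))) else 0) *
              hid σ Kn L r d w k m j x) +
          (if h : m < L - 1 then w (Sum.inr (Sum.inl (k, ⟨m, h⟩, i, 0))) else 0))

/-- Output `f^{(L)}_{k,1}` of the `k`-th fully connected subnetwork. -/
def subnet (σ : ℝ → ℝ) (Kn L r d : ℕ) (w : EuclideanSpace ℝ (Idx Kn L r d)) (k : Fin Kn)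
    (x : Fin d → ℝ) : ℝ :=
  if h : 0 < r then hid σ Kn L r d w k (L - 1) ⟨0, h⟩ x else 0

/-- The deep network `f_w(x) = ∑_{j=1}^{K_n} w^{(L)}_{1,1,j} · f^{(L)}_{j,1}(x)`. -/
def netF (σ : ℝ → ℝ) (Kn L r d : ℕ) (w : EuclideanSpace ℝ (Idx Kn L r d))
    (x : Fin d → ℝ) : ℝ :=
  ∑ j : Fin Kn, w (Sum.inr (Sum.inr j)) * subnet σ Kn L r d w j x

/-- Indicator function of the cube `[-α,α]^d`. -/
def cubeInd (d : ℕ) (α : ℝ) (x : Fin d → ℝ) : ℝ :=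
  Set.indicator {y : Fin d → ℝ | ∀ j, |y j| ≤ α} (fun _ => (1 : ℝ)) x

/-- The regularized empirical L₂ risk
`F_n(w) = (1/n) ∑_i |f_w(X_i) - Y_i|² 1_{[-α_n,α_n]^d}(X_i) + c₂ ∑_j |w^{(L)}_{1,1,j}|²`. -/
def empRisk (σ : ℝ → ℝ) (Kn L r d n : ℕ) (X : Fin n → Fin d → ℝ) (Y : Fin n → ℝ)
    (αn c2 : ℝ) (w : EuclideanSpace ℝ (Idx Kn L r d)) : ℝ :=
  (1 / (n : ℝ)) * ∑ i : Fin n, (netF σ Kn L r d w (X i) - Y i) ^ 2 * cubeInd d αn (X i)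
    + c2 * ∑ j : Fin Kn, (w (Sum.inr (Sum.inr j))) ^ 2

/-- Truncation operator `T_β z = max{-β, min{β, z}}`. -/
def Tbeta (β z : ℝ) : ℝ := max (-β) (min β z)

theorem norm_smul_sub_smul_le {V : Type*} [NormedAddCommGroup V] [NormedSpace ℝ V]
    {a a' P p Q q : ℝ} {u u' : V} (ha : |a| ≤ P) (hu' : ‖u'‖ ≤ Q) (haa' : |a - a'| ≤ p)
    (huu' : ‖u - u'‖ ≤ q) : ‖a • u - a' • u'‖ ≤ P * q + p * Q := by
  have h : a • u - a' • u' = a • (u - u') + (a - a') • u' := by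
    rw [smul_sub, sub_smul]; abel
  rw [h]
  refine (norm_add_le _ _).trans ?_
  rw [norm_smul, norm_smul, Real.norm_eq_abs, Real.norm_eq_abs]
  exact add_le_add
    (mul_le_mul ha huu' (norm_nonneg _) ((abs_nonneg _).trans ha))
    (mul_le_mul haa' hu' (norm_nonneg _) ((abs_nonneg _).trans haa'))

section WeightedSum

variable {E ι : Type*} [NormedAddCommGroup E] [NormedSpace ℝ E] [Fintype ι]
  {c : ι → E →L[ℝ] ℝ} {h : ι → E → ℝ}

theorem hasFDerivAt_weightedSum (hd : ∀ j, Differentiable ℝ (h j)) (w : E) :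
    HasFDerivAt (fun u => ∑ j, c j u * h j u)
      (∑ j, (c j w • fderiv ℝ (h j) w + h j w • c j)) w :=
  HasFDerivAt.fun_sum fun j _ => (c j).hasFDerivAt.mul (hd j w).hasFDerivAt

theorem abs_weightedSum_sub_le {A B : ℝ} {H δ : ι → ℝ} {w v : E} (hc : ∀ j, |c j w| ≤ B)
    (hA : ∀ j, |h j v| ≤ A) (hδ : ∀ j, |c j w - c j v| ≤ δ j)
    (hH : ∀ j, |h j w - h j v| ≤ H j) :
    |(∑ j, c j w * h j w) - ∑ j, c j v * h j v| ≤ ∑ j, (B * H j + δ j * A) := by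
  rw [← Finset.sum_sub_distrib]
  exact (Finset.abs_sum_le_sum_abs _ _).trans <| Finset.sum_le_sum fun j _ =>
    norm_smul_sub_smul_le (u := h j w) (u' := h j v) (hc j) (hA j) (hδ j) (hH j)

theorem norm_fderiv_weightedSum_le {A B D : ℝ} {w : E} (hd : ∀ j, Differentiable ℝ (h j))
    (hc1 : ∀ j, ‖c j‖ ≤ 1) (hc : ∀ j, |c j w| ≤ B) (hA : ∀ j, |h j w| ≤ A)
    (hD : ∀ j, ‖fderiv ℝ (h j) w‖ ≤ D) :
    ‖fderiv ℝ (fun u => ∑ j, c j u * h j u) w‖ ≤ Fintype.card ι * (B * D + A) := by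
  rw [(hasFDerivAt_weightedSum hd w).fderiv]
  refine (norm_sum_le_of_le (n := fun _ => B * D + A) _ fun j _ => ?_).trans_eq ?_
  · refine (norm_add_le _ _).trans ?_
    rw [norm_smul, norm_smul, Real.norm_eq_abs, Real.norm_eq_abs]
    refine add_le_add (mul_le_mul (hc j) (hD j) (norm_nonneg _) ((abs_nonneg _).trans (hc j))) ?_
    simpa using mul_le_mul (hA j) (hc1 j) (norm_nonneg _) ((abs_nonneg _).trans (hA j))
  · simp [mul_add]

theorem norm_fderiv_weightedSum_sub_le {B D H K δ : ℝ} {w v : E}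
    (hd : ∀ j, Differentiable ℝ (h j)) (hc1 : ∀ j, ‖c j‖ ≤ 1) (hc : ∀ j, |c j w| ≤ B)
    (hδ : ∀ j, |c j w - c j v| ≤ δ) (hH : ∀ j, |h j w - h j v| ≤ H)
    (hD : ∀ j, ‖fderiv ℝ (h j) v‖ ≤ D) (hK : ∀ j, ‖fderiv ℝ (h j) w - fderiv ℝ (h j) v‖ ≤ K) :
    ‖fderiv ℝ (fun u => ∑ j, c j u * h j u) w - fderiv ℝ (fun u => ∑ j, c j u * h j u) v‖ ≤
      Fintype.card ι * (B * K + δ * D + H) := by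
  rw [(hasFDerivAt_weightedSum hd w).fderiv, (hasFDerivAt_weightedSum hd v).fderiv,
    ← Finset.sum_sub_distrib]
  refine (norm_sum_le_of_le (n := fun _ => B * K + δ * D + H) _ fun j _ => ?_).trans_eq ?_
  · rw [add_sub_add_comm, ← sub_smul]
    refine (norm_add_le _ _).trans
      (add_le_add (norm_smul_sub_smul_le (hc j) (hD j) (hδ j) (hK j)) ?_)
    rw [norm_smul, Real.norm_eq_abs]
    simpa using mul_le_mul (hH j) (hc1 j) (norm_nonneg _) ((abs_nonneg _).trans (hH j))
  · simp [mul_add]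

end WeightedSum

theorem EuclideanSpace.norm_proj_le_one {ι : Type*} [Fintype ι] (a : ι) :
    ‖(EuclideanSpace.proj a : EuclideanSpace ℝ ι →L[ℝ] ℝ)‖ ≤ 1 :=
  ContinuousLinearMap.opNorm_le_bound _ zero_le_one fun x => by
    simpa using PiLp.norm_apply_le x a

section Network

variable {Kn L r d : ℕ}

/-- Euclidean distance between the weights of the `k`-th subnetworks, including the output weight. -/
def blockDist (w v : EuclideanSpace ℝ (Idx Kn L r d)) (k : Fin Kn) : ℝ :=
  Real.sqrt ((∑ p : Fin r × Fin (d + 1), (w (Sum.inl (k, p)) - v (Sum.inl (k, p))) ^ 2) +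
    ((∑ p : Fin (L - 1) × Fin r × Fin (r + 1),
      (w (Sum.inr (Sum.inl (k, p))) - v (Sum.inr (Sum.inl (k, p)))) ^ 2) +
    (w (Sum.inr (Sum.inr k)) - v (Sum.inr (Sum.inr k))) ^ 2))

theorem blockDist_nonneg (w v : EuclideanSpace ℝ (Idx Kn L r d)) (k : Fin Kn) :
    0 ≤ blockDist w v k := Real.sqrt_nonneg _

theorem abs_input_sub_le_blockDist (w v : EuclideanSpace ℝ (Idx Kn L r d)) (k : Fin Kn)
    (p : Fin r × Fin (d + 1)) :
    |w (Sum.inl (k, p)) - v (Sum.inl (k, p))| ≤ blockDist w v k := by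
  refine Real.abs_le_sqrt ?_
  have := Finset.single_le_sum (f := fun p => (w (Sum.inl (k, p)) - v (Sum.inl (k, p))) ^ 2)
    (fun _ _ => sq_nonneg _) (Finset.mem_univ p)
  refine this.trans (le_add_of_nonneg_right ?_)
  positivity

theorem abs_inner_sub_le_blockDist (w v : EuclideanSpace ℝ (Idx Kn L r d)) (k : Fin Kn)
    (p : Fin (L - 1) × Fin r × Fin (r + 1)) :
    |w (Sum.inr (Sum.inl (k, p))) - v (Sum.inr (Sum.inl (k, p)))| ≤ blockDist w v k := by
  refine Real.abs_le_sqrt ?_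
  have := Finset.single_le_sum
    (f := fun p => (w (Sum.inr (Sum.inl (k, p))) - v (Sum.inr (Sum.inl (k, p)))) ^ 2)
    (fun _ _ => sq_nonneg _) (Finset.mem_univ p)
  refine this.trans ((le_add_of_nonneg_right (sq_nonneg _)).trans (le_add_of_nonneg_left ?_))
  positivity

theorem abs_output_sub_le_blockDist (w v : EuclideanSpace ℝ (Idx Kn L r d)) (k : Fin Kn) :
    |w (Sum.inr (Sum.inr k)) - v (Sum.inr (Sum.inr k))| ≤ blockDist w v k := by
  refine Real.abs_le_sqrt ?_
  rw [← add_assoc]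
  refine le_add_of_nonneg_left ?_
  positivity

theorem sum_blockDist_sq (w v : EuclideanSpace ℝ (Idx Kn L r d)) :
    ∑ k, blockDist w v k ^ 2 = ‖w - v‖ ^ 2 := by
  have h : ∀ k, blockDist w v k ^ 2 = _ := fun k => Real.sq_sqrt (by positivity)
  simp only [h, Finset.sum_add_distrib, EuclideanSpace.norm_sq_eq, Fintype.sum_sum_type,
    Fintype.sum_prod_type, PiLp.sub_apply, Real.norm_eq_abs, sq_abs]

theorem blockDist_le_norm (w v : EuclideanSpace ℝ (Idx Kn L r d)) (k : Fin Kn) :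
    blockDist w v k ≤ ‖w - v‖ := by
  refine abs_le_of_sq_le_sq' ?_ (norm_nonneg _) |>.2
  rw [← sum_blockDist_sq]
  exact Finset.single_le_sum (f := fun k => blockDist w v k ^ 2) (fun _ _ => sq_nonneg _)
    (Finset.mem_univ k)

theorem sum_blockDist_le (w v : EuclideanSpace ℝ (Idx Kn L r d)) :
    ∑ k, blockDist w v k ≤ Real.sqrt Kn * ‖w - v‖ := by
  have h := sq_sum_le_card_mul_sum_sq (s := Finset.univ) (f := blockDist w v)
  rw [sum_blockDist_sq, Finset.card_univ, Fintype.card_fin] at h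
  refine (Real.le_sqrt_of_sq_le h).trans_eq ?_
  rw [Real.sqrt_mul (Nat.cast_nonneg _), Real.sqrt_sq (norm_nonneg _)]

/-- The inner weights `w^{(l)}_{k,i,j}`, `1 ≤ l ≤ L - 1`, are bounded by `B` in absolute value. -/
def InnerWeightsLe (B : ℝ) (w : EuclideanSpace ℝ (Idx Kn L r d)) : Prop :=
  ∀ k l i j, |w (Sum.inr (Sum.inl (k, l, i, j)))| ≤ B

/-- The linear form reading off the weight of layer `m + 1`, extended by zero for `m ≥ L - 1`. -/
def innerCoord (k : Fin Kn) (m : ℕ) (i : Fin r) (j : Fin (r + 1)) :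
    EuclideanSpace ℝ (Idx Kn L r d) →L[ℝ] ℝ :=
  if h : m < L - 1 then EuclideanSpace.proj (Sum.inr (Sum.inl (k, ⟨m, h⟩, i, j))) else 0

theorem innerCoord_apply (k : Fin Kn) (m : ℕ) (i : Fin r) (j : Fin (r + 1))
    (w : EuclideanSpace ℝ (Idx Kn L r d)) :
    innerCoord k m i j w =
      if h : m < L - 1 then w (Sum.inr (Sum.inl (k, ⟨m, h⟩, i, j))) else 0 := by
  unfold innerCoord
  split_ifs <;> simp

theorem norm_innerCoord_le (k : Fin Kn) (m : ℕ) (i : Fin r) (j : Fin (r + 1)) :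
    ‖(innerCoord k m i j : EuclideanSpace ℝ (Idx Kn L r d) →L[ℝ] ℝ)‖ ≤ 1 := by
  unfold innerCoord
  split_ifs
  · exact EuclideanSpace.norm_proj_le_one _
  · simp

theorem abs_innerCoord_le {B : ℝ} (hB : 1 ≤ B) {w : EuclideanSpace ℝ (Idx Kn L r d)}
    (hw : InnerWeightsLe B w) (k : Fin Kn) (m : ℕ) (i : Fin r) (j : Fin (r + 1)) :
    |innerCoord k m i j w| ≤ B := by
  rw [innerCoord_apply]
  split_ifs
  · exact hw _ _ _ _
  · simpa using zero_le_one.trans hB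

theorem abs_innerCoord_sub_le (w v : EuclideanSpace ℝ (Idx Kn L r d)) (k : Fin Kn) (m : ℕ)
    (i : Fin r) (j : Fin (r + 1)) :
    |innerCoord k m i j w - innerCoord k m i j v| ≤ blockDist w v k := by
  rw [innerCoord_apply, innerCoord_apply]
  split_ifs
  · exact abs_inner_sub_le_blockDist _ _ _ _
  · simpa using blockDist_nonneg w v k

/-- The linear preactivation of neuron `i` in the first layer. -/
def inputPreact (k : Fin Kn) (i : Fin r) (x : Fin d → ℝ) :
    EuclideanSpace ℝ (Idx Kn L r d) →L[ℝ] ℝ :=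
  (∑ j : Fin d, x j • EuclideanSpace.proj (Sum.inl (k, i, j.succ))) +
    EuclideanSpace.proj (Sum.inl (k, i, 0))

theorem hid_zero (σ : ℝ → ℝ) (w : EuclideanSpace ℝ (Idx Kn L r d)) (k : Fin Kn) (i : Fin r)
    (x : Fin d → ℝ) : hid σ Kn L r d w k 0 i x = σ (inputPreact k i x w) := by
  simp [hid, inputPreact, mul_comm]

theorem hid_succ (σ : ℝ → ℝ) (w : EuclideanSpace ℝ (Idx Kn L r d)) (k : Fin Kn) (m : ℕ)
    (i : Fin r) (x : Fin d → ℝ) :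
    hid σ Kn L r d w k (m + 1) i x =
      σ ((∑ j : Fin r, innerCoord k m i j.succ w * hid σ Kn L r d w k m j x) +
        innerCoord k m i 0 w) := by
  simp only [hid, innerCoord_apply]

theorem abs_hid_le {σ : ℝ → ℝ} {A : ℝ} (hσ : ∀ t, |σ t| ≤ A)
    (w : EuclideanSpace ℝ (Idx Kn L r d)) (k : Fin Kn) (m : ℕ) (i : Fin r) (x : Fin d → ℝ) :
    |hid σ Kn L r d w k m i x| ≤ A := by
  cases m <;> exact hσ _

theorem norm_inputPreact_le {α : ℝ} (hα : 1 ≤ α) {x : Fin d → ℝ} (hx : ∀ j, |x j| ≤ α)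
    (k : Fin Kn) (i : Fin r) :
    ‖(inputPreact k i x : EuclideanSpace ℝ (Idx Kn L r d) →L[ℝ] ℝ)‖ ≤ (d + 1) * α := by
  have h : ∑ _j : Fin d, α + α = (d + 1) * α := by simp; ring
  rw [← h]
  refine (norm_add_le _ _).trans (add_le_add (norm_sum_le_of_le _ fun j _ => ?_)
    ((EuclideanSpace.norm_proj_le_one _).trans hα))
  rw [norm_smul, Real.norm_eq_abs]
  simpa using mul_le_mul (hx j) (EuclideanSpace.norm_proj_le_one (Sum.inl (k, i, j.succ)))
    (norm_nonneg _) (zero_le_one.trans hα)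

theorem abs_inputPreact_sub_le {α : ℝ} (hα : 1 ≤ α) {x : Fin d → ℝ} (hx : ∀ j, |x j| ≤ α)
    (w v : EuclideanSpace ℝ (Idx Kn L r d)) (k : Fin Kn) (i : Fin r) :
    |inputPreact k i x w - inputPreact k i x v| ≤ (d + 1) * α * blockDist w v k := by
  have hδ := blockDist_nonneg w v k
  have h : ∑ _j : Fin d, α * blockDist w v k + α * blockDist w v k =
      (d + 1) * α * blockDist w v k := by simp; ring
  rw [← h, ← map_sub]
  simp only [inputPreact, add_apply, sum_apply,
    smul_apply, PiLp.proj_apply, smul_eq_mul, PiLp.sub_apply]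
  refine (abs_add_le _ _).trans (add_le_add ((Finset.abs_sum_le_sum_abs _ _).trans
    (Finset.sum_le_sum fun j _ => ?_)) ?_)
  · rw [abs_mul]
    exact mul_le_mul (hx j) (abs_input_sub_le_blockDist _ _ _ _) (abs_nonneg _)
      (zero_le_one.trans hα)
  · exact (abs_input_sub_le_blockDist _ _ _ _).trans (le_mul_of_one_le_left hδ hα)

end Network

/-- Bounds, uniform in the number of subnetworks, for a family `φ` of functions of the weights
of the kind attached to layer `m + 1` of a subnetwork. -/
structure LayerBounds (L r d m : ℕ) (C : ℝ)
    (φ : ∀ Kn : ℕ, Fin Kn → Fin r → (Fin d → ℝ) → EuclideanSpace ℝ (Idx Kn L r d) → ℝ) :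
    Prop where
  differentiable : ∀ Kn k i x, Differentiable ℝ (φ Kn k i x)
  abs_sub_le : ∀ Kn k i x (α B : ℝ) (w v : EuclideanSpace ℝ (Idx Kn L r d)), 1 ≤ α → 1 ≤ B →
    (∀ j, |x j| ≤ α) → InnerWeightsLe B w →
    |φ Kn k i x w - φ Kn k i x v| ≤ C * (B ^ m * α * blockDist w v k)
  norm_fderiv_le : ∀ Kn k i x (α B : ℝ) (w : EuclideanSpace ℝ (Idx Kn L r d)), 1 ≤ α → 1 ≤ B →
    (∀ j, |x j| ≤ α) → InnerWeightsLe B w →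
    ‖fderiv ℝ (φ Kn k i x) w‖ ≤ C * (B ^ m * α)
  norm_fderiv_sub_le : ∀ Kn k i x (α B : ℝ) (w v : EuclideanSpace ℝ (Idx Kn L r d)), 1 ≤ α →
    1 ≤ B → (∀ j, |x j| ≤ α) → InnerWeightsLe B w → InnerWeightsLe B v →
    ‖fderiv ℝ (φ Kn k i x) w - fderiv ℝ (φ Kn k i x) v‖ ≤
      C * (B ^ (2 * m) * α ^ 2 * blockDist w v k)

theorem layerBounds_inputPreact (L r d : ℕ) :
    LayerBounds L r d 0 (d + 1) fun _ k i x => inputPreact k i x where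
  differentiable _ k i x := (inputPreact k i x).differentiable
  abs_sub_le Kn k i x α B w v hα _ hx _ := by
    simpa [mul_assoc] using abs_inputPreact_sub_le hα hx w v k i
  norm_fderiv_le Kn k i x α B w hα _ hx _ := by
    simpa using norm_inputPreact_le hα hx k i
  norm_fderiv_sub_le Kn k i x α B w v hα _ hx _ _ := by
    have := blockDist_nonneg w v k
    simp only [ContinuousLinearMap.fderiv, sub_self, norm_zero]
    positivity

/-- `σ` is differentiable and `A` bounds `|σ|`, `|σ'|` and the Lipschitz constant of `σ'`. -/
structure ActivationBounds (σ : ℝ → ℝ) (A : ℝ) : Prop where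
  one_le : 1 ≤ A
  differentiable : Differentiable ℝ σ
  abs_le : ∀ t, |σ t| ≤ A
  abs_deriv_le : ∀ t, |deriv σ t| ≤ A
  abs_deriv_sub_le : ∀ s t, |deriv σ s - deriv σ t| ≤ A * |s - t|

namespace ActivationBounds

variable {σ : ℝ → ℝ} {A : ℝ}

theorem nonneg (hσ : ActivationBounds σ A) : 0 ≤ A := zero_le_one.trans hσ.one_le

theorem abs_sub_le (hσ : ActivationBounds σ A) (s t : ℝ) : |σ s - σ t| ≤ A * |s - t| := by
  simpa using convex_univ.norm_image_sub_le_of_norm_deriv_le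
    (fun x _ => hσ.differentiable x) (fun x _ => hσ.abs_deriv_le x)
    (Set.mem_univ t) (Set.mem_univ s)

theorem layerBounds_comp (hσ : ActivationBounds σ A) {L r d m : ℕ} {C : ℝ}
    {φ : ∀ Kn : ℕ, Fin Kn → Fin r → (Fin d → ℝ) → EuclideanSpace ℝ (Idx Kn L r d) → ℝ}
    (hC : 1 ≤ C) (hφ : LayerBounds L r d m C φ) :
    LayerBounds L r d m (A * C + A * C * C) fun Kn k i x w => σ (φ Kn k i x w) := by
  have hA := hσ.nonneg
  have hderiv : ∀ Kn k i x (w : EuclideanSpace ℝ (Idx Kn L r d)),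
      fderiv ℝ (fun u => σ (φ Kn k i x u)) w =
        deriv σ (φ Kn k i x w) • fderiv ℝ (φ Kn k i x) w := fun Kn k i x w =>
    ((hσ.differentiable _).hasDerivAt.comp_hasFDerivAt w
      (hφ.differentiable Kn k i x w).hasFDerivAt).fderiv
  have hCC : A * C ≤ A * C + A * C * C := le_add_of_nonneg_right (by positivity)
  refine ⟨fun Kn k i x => hσ.differentiable.comp (hφ.differentiable Kn k i x), ?_, ?_, ?_⟩
  · intro Kn k i x α B w v hα hB hx hw
    have hδ := blockDist_nonneg w v k
    refine (hσ.abs_sub_le _ _).trans ?_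
    refine (mul_le_mul_of_nonneg_left (hφ.abs_sub_le Kn k i x α B w v hα hB hx hw) hA).trans ?_
    rw [← mul_assoc]
    exact mul_le_mul_of_nonneg_right hCC (by positivity)
  · intro Kn k i x α B w hα hB hx hw
    rw [hderiv, norm_smul]
    refine (mul_le_mul (hσ.abs_deriv_le _) (hφ.norm_fderiv_le Kn k i x α B w hα hB hx hw)
      (norm_nonneg _) hA).trans ?_
    rw [← mul_assoc]
    exact mul_le_mul_of_nonneg_right hCC (by positivity)
  · intro Kn k i x α B w v hα hB hx hw hv
    rw [hderiv, hderiv]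
    refine (norm_smul_sub_smul_le (hσ.abs_deriv_le _)
      (hφ.norm_fderiv_le Kn k i x α B v hα hB hx hv)
      ((hσ.abs_deriv_sub_le _ _).trans
        (mul_le_mul_of_nonneg_left (hφ.abs_sub_le Kn k i x α B w v hα hB hx hw) hA))
      (hφ.norm_fderiv_sub_le Kn k i x α B w v hα hB hx hw hv)).trans_eq ?_
    ring

theorem layerBounds_preact (hσ : ActivationBounds σ A) {L r d m : ℕ} {C : ℝ} (hC : 1 ≤ C)
    (hφ : LayerBounds L r d m C fun Kn k i x w => hid σ Kn L r d w k m i x) :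
    LayerBounds L r d (m + 1) (r * (3 * C + A) + 1) fun Kn k i x w =>
      (∑ j : Fin r, innerCoord k m i j.succ w * hid σ Kn L r d w k m j x) +
        innerCoord k m i 0 w := by
  have hA := hσ.nonneg
  have hC0 : 0 ≤ C := zero_le_one.trans hC
  have hsum : ∀ Kn k (i : Fin r) x, Differentiable ℝ
      (fun w : EuclideanSpace ℝ (Idx Kn L r d) =>
        ∑ j : Fin r, innerCoord k m i j.succ w * hid σ Kn L r d w k m j x) :=
    fun Kn k i x w => (hasFDerivAt_weightedSum (fun j => hφ.differentiable Kn k j x)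
      w).differentiableAt
  have hderiv : ∀ Kn k (i : Fin r) x (w : EuclideanSpace ℝ (Idx Kn L r d)),
      fderiv ℝ (fun w : EuclideanSpace ℝ (Idx Kn L r d) =>
        (∑ j : Fin r, innerCoord k m i j.succ w * hid σ Kn L r d w k m j x) +
          innerCoord k m i 0 w) w =
      fderiv ℝ (fun w : EuclideanSpace ℝ (Idx Kn L r d) =>
        ∑ j : Fin r, innerCoord k m i j.succ w * hid σ Kn L r d w k m j x) w +
        innerCoord k m i 0 := fun Kn k i x w =>
    ((hsum Kn k i x w).hasFDerivAt.add (innerCoord k m i 0).hasFDerivAt).fderiv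
  refine ⟨fun Kn k i x => (hsum Kn k i x).add (innerCoord k m i 0).differentiable, ?_, ?_, ?_⟩
  · intro Kn k i x α B w v hα hB hx hw
    have hδ := blockDist_nonneg w v k
    have hT : blockDist w v k ≤ B ^ (m + 1) * α * blockDist w v k :=
      le_mul_of_one_le_left hδ (one_le_mul_of_one_le_of_one_le (one_le_pow₀ hB) hα)
    rw [add_sub_add_comm]
    refine (abs_add_le _ _).trans ((add_le_add (abs_weightedSum_sub_le
      (c := fun j : Fin r => innerCoord k m i j.succ)
      (h := fun j u => hid σ Kn L r d u k m j x)
      (fun j => abs_innerCoord_le hB hw k m i j.succ) (fun j => abs_hid_le hσ.abs_le v k m j x)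
      (fun j => abs_innerCoord_sub_le w v k m i j.succ)
      (fun j => hφ.abs_sub_le Kn k j x α B w v hα hB hx hw))
      (abs_innerCoord_sub_le w v k m i 0)).trans ?_)
    simp only [Finset.sum_const, Finset.card_univ, Fintype.card_fin, nsmul_eq_mul]
    calc (r : ℝ) * (B * (C * (B ^ m * α * blockDist w v k)) + blockDist w v k * A)
          + blockDist w v k
        = r * (C * (B ^ (m + 1) * α * blockDist w v k) + A * blockDist w v k)
          + blockDist w v k := by ring
      _ ≤ r * (3 * C * (B ^ (m + 1) * α * blockDist w v k)
            + A * (B ^ (m + 1) * α * blockDist w v k))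
          + B ^ (m + 1) * α * blockDist w v k := by
        gcongr
        linarith
      _ = _ := by ring
  · intro Kn k i x α B w hα hB hx hw
    have hT : 1 ≤ B ^ (m + 1) * α := one_le_mul_of_one_le_of_one_le (one_le_pow₀ hB) hα
    rw [hderiv]
    refine (norm_add_le _ _).trans ((add_le_add (norm_fderiv_weightedSum_le
      (c := fun j : Fin r => innerCoord k m i j.succ)
      (h := fun j u => hid σ Kn L r d u k m j x)
      (fun j => hφ.differentiable Kn k j x)
      (fun j => norm_innerCoord_le k m i j.succ)
      (fun j => abs_innerCoord_le hB hw k m i j.succ) (fun j => abs_hid_le hσ.abs_le w k m j x)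
      (fun j => hφ.norm_fderiv_le Kn k j x α B w hα hB hx hw))
      (norm_innerCoord_le k m i 0)).trans ?_)
    rw [Fintype.card_fin]
    calc (r : ℝ) * (B * (C * (B ^ m * α)) + A) + 1
        = r * (C * (B ^ (m + 1) * α) + A * 1) + 1 := by ring
      _ ≤ r * (3 * C * (B ^ (m + 1) * α) + A * (B ^ (m + 1) * α)) + B ^ (m + 1) * α := by
        gcongr
        linarith
      _ = _ := by ring
  · intro Kn k i x α B w v hα hB hx hw hv
    have hδ := blockDist_nonneg w v k
    have hB0 : 0 ≤ B := zero_le_one.trans hB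
    have hα0 : 0 ≤ α := zero_le_one.trans hα
    rw [hderiv, hderiv, add_sub_add_right_eq_sub]
    refine (norm_fderiv_weightedSum_sub_le
      (c := fun j : Fin r => innerCoord k m i j.succ)
      (h := fun j u => hid σ Kn L r d u k m j x)
      (fun j => hφ.differentiable Kn k j x)
      (fun j => norm_innerCoord_le k m i j.succ)
      (fun j => abs_innerCoord_le hB hw k m i j.succ)
      (fun j => abs_innerCoord_sub_le w v k m i j.succ)
      (fun j => hφ.abs_sub_le Kn k j x α B w v hα hB hx hw)
      (fun j => hφ.norm_fderiv_le Kn k j x α B v hα hB hx hv)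
      (fun j => hφ.norm_fderiv_sub_le Kn k j x α B w v hα hB hx hw hv)).trans ?_
    rw [Fintype.card_fin]
    set δ := blockDist w v k
    have h1 : B ^ (2 * m + 1) ≤ B ^ (2 * (m + 1)) := pow_le_pow_right₀ hB (by omega)
    have h2 : B ^ m ≤ B ^ (2 * (m + 1)) := pow_le_pow_right₀ hB (by omega)
    have h3 : α ≤ α ^ 2 := le_self_pow₀ hα two_ne_zero
    have hT : 0 ≤ B ^ (2 * (m + 1)) * α ^ 2 * δ := by positivity
    calc (r : ℝ) * (B * (C * (B ^ (2 * m) * α ^ 2 * δ)) + δ * (C * (B ^ m * α))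
          + C * (B ^ m * α * δ))
        = r * (C * (B ^ (2 * m + 1) * α ^ 2 * δ) + C * (B ^ m * α * δ)
          + C * (B ^ m * α * δ)) := by ring
      _ ≤ r * (C * (B ^ (2 * (m + 1)) * α ^ 2 * δ) + C * (B ^ (2 * (m + 1)) * α ^ 2 * δ)
          + C * (B ^ (2 * (m + 1)) * α ^ 2 * δ)) := by gcongr
      _ = r * (3 * C) * (B ^ (2 * (m + 1)) * α ^ 2 * δ) := by ring
      _ ≤ _ := by
        gcongr
        nlinarith [mul_nonneg (Nat.cast_nonneg (α := ℝ) r) hA]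

theorem exists_layerBounds_hid (hσ : ActivationBounds σ A) (L r d m : ℕ) :
    ∃ C, 1 ≤ C ∧ LayerBounds L r d m C fun Kn k i x w => hid σ Kn L r d w k m i x := by
  have hA := hσ.one_le
  have hA0 := hσ.nonneg
  have key : ∀ C : ℝ, 1 ≤ C → 1 ≤ A * C + A * C * C := fun C hC => by
    have := one_le_mul_of_one_le_of_one_le hA hC
    nlinarith
  induction m with
  | zero =>
    have hC : (1 : ℝ) ≤ d + 1 := le_add_of_nonneg_left (Nat.cast_nonneg _)
    exact ⟨_, key _ hC, by
      simpa only [hid_zero] using hσ.layerBounds_comp hC (layerBounds_inputPreact L r d)⟩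
  | succ m ih =>
    obtain ⟨C, hC, h⟩ := ih
    have hC' : 1 ≤ r * (3 * C + A) + 1 :=
      le_add_of_nonneg_left (mul_nonneg (Nat.cast_nonneg _) (by linarith))
    exact ⟨_, key _ hC', by
      simpa only [hid_succ] using hσ.layerBounds_comp hC' (hσ.layerBounds_preact hC h)⟩

end ActivationBounds

/-- Bounds for the network, as a function of the weights, on the weights whose output part is
bounded by `γ` and whose inner part is bounded by `B`. -/
structure NetBounds (σ : ℝ → ℝ) (L r d : ℕ) (C : ℝ) : Prop where
  differentiable : ∀ Kn (x : Fin d → ℝ), Differentiable ℝ fun w => netF σ Kn L r d w x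
  abs_sub_le : ∀ Kn (x : Fin d → ℝ) (α B γ : ℝ) (w v : EuclideanSpace ℝ (Idx Kn L r d)),
    1 ≤ α → 1 ≤ B → 1 ≤ γ → (∀ j, |x j| ≤ α) → InnerWeightsLe B w →
    (∀ k, |w (Sum.inr (Sum.inr k))| ≤ γ) →
    |netF σ Kn L r d w x - netF σ Kn L r d v x| ≤
      C * (Real.sqrt Kn * γ * B ^ L * α * ‖w - v‖)
  norm_fderiv_le : ∀ Kn (x : Fin d → ℝ) (α B γ : ℝ) (w : EuclideanSpace ℝ (Idx Kn L r d)),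
    1 ≤ α → 1 ≤ B → 1 ≤ γ → (∀ j, |x j| ≤ α) → InnerWeightsLe B w →
    (∀ k, |w (Sum.inr (Sum.inr k))| ≤ γ) →
    ‖fderiv ℝ (fun w => netF σ Kn L r d w x) w‖ ≤ C * (Kn * γ * B ^ L * α)
  norm_fderiv_sub_le : ∀ Kn (x : Fin d → ℝ) (α B γ : ℝ)
    (w v : EuclideanSpace ℝ (Idx Kn L r d)),
    1 ≤ α → 1 ≤ B → 1 ≤ γ → (∀ j, |x j| ≤ α) → InnerWeightsLe B w → InnerWeightsLe B v →
    (∀ k, |w (Sum.inr (Sum.inr k))| ≤ γ) →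
    ‖fderiv ℝ (fun w => netF σ Kn L r d w x) w - fderiv ℝ (fun w => netF σ Kn L r d w x) v‖ ≤
      C * (Kn * γ * B ^ (2 * L) * α ^ 2 * ‖w - v‖)

theorem netF_eq_weightedSum (σ : ℝ → ℝ) {Kn L r d : ℕ} (hr : 0 < r) (x : Fin d → ℝ)
    (w : EuclideanSpace ℝ (Idx Kn L r d)) :
    netF σ Kn L r d w x = ∑ k, (EuclideanSpace.proj (Sum.inr (Sum.inr k)) :
      EuclideanSpace ℝ (Idx Kn L r d) →L[ℝ] ℝ) w * hid σ Kn L r d w k (L - 1) ⟨0, hr⟩ x := by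
  simp [netF, subnet, hr]

theorem ActivationBounds.exists_netBounds {σ : ℝ → ℝ} {A : ℝ} (hσ : ActivationBounds σ A)
    {L r : ℕ} (d : ℕ) (hr : 0 < r) : ∃ C, 1 ≤ C ∧ NetBounds σ L r d C := by
  obtain ⟨C, hC, h⟩ := hσ.exists_layerBounds_hid L r d (L - 1)
  have hA := hσ.nonneg
  have hC0 : 0 ≤ C := zero_le_one.trans hC
  refine ⟨3 * C + A, by linarith, ?_, ?_, ?_, ?_⟩
  all_goals simp only [netF_eq_weightedSum σ hr]
  · exact fun Kn x w => (hasFDerivAt_weightedSum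
      (h := fun k u => hid σ Kn L r d u k (L - 1) ⟨0, hr⟩ x)
      (fun k => h.differentiable Kn k ⟨0, hr⟩ x) w).differentiableAt
  · intro Kn x α B γ w v hα hB hγ hx hw hwo
    refine (abs_weightedSum_sub_le
      (c := fun k : Fin Kn => EuclideanSpace.proj (Sum.inr (Sum.inr k)))
      (h := fun k u => hid σ Kn L r d u k (L - 1) ⟨0, hr⟩ x)
      hwo (fun k => abs_hid_le hσ.abs_le v k (L - 1) ⟨0, hr⟩ x)
      (fun k => abs_output_sub_le_blockDist w v k)
      (fun k => h.abs_sub_le Kn k ⟨0, hr⟩ x α B w v hα hB hx hw)).trans ?_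
    have hpow : B ^ (L - 1) ≤ B ^ L := pow_le_pow_right₀ hB (Nat.sub_le _ _)
    have hone : 1 ≤ γ * B ^ L * α := one_le_mul_of_one_le_of_one_le
      (one_le_mul_of_one_le_of_one_le hγ (one_le_pow₀ hB)) hα
    calc ∑ k, (γ * (C * (B ^ (L - 1) * α * blockDist w v k)) + blockDist w v k * A)
        = (C * (γ * B ^ (L - 1) * α) + A * 1) * ∑ k, blockDist w v k := by
          rw [Finset.mul_sum]
          exact Finset.sum_congr rfl fun k _ => by ring
      _ ≤ (3 * C * (γ * B ^ L * α) + A * (γ * B ^ L * α)) * (Real.sqrt Kn * ‖w - v‖) := by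
          gcongr
          · exact Finset.sum_nonneg fun k _ => blockDist_nonneg w v k
          · linarith
          · exact sum_blockDist_le w v
      _ = _ := by ring
  · intro Kn x α B γ w hα hB hγ hx hw hwo
    refine (norm_fderiv_weightedSum_le
      (c := fun k : Fin Kn => EuclideanSpace.proj (Sum.inr (Sum.inr k)))
      (h := fun k u => hid σ Kn L r d u k (L - 1) ⟨0, hr⟩ x)
      (fun k => h.differentiable Kn k ⟨0, hr⟩ x)
      (fun k => EuclideanSpace.norm_proj_le_one _)
      hwo (fun k => abs_hid_le hσ.abs_le w k (L - 1) ⟨0, hr⟩ x)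
      (fun k => h.norm_fderiv_le Kn k ⟨0, hr⟩ x α B w hα hB hx hw)).trans ?_
    have hpow : B ^ (L - 1) ≤ B ^ L := pow_le_pow_right₀ hB (Nat.sub_le _ _)
    have hone : 1 ≤ γ * B ^ L * α := one_le_mul_of_one_le_of_one_le
      (one_le_mul_of_one_le_of_one_le hγ (one_le_pow₀ hB)) hα
    rw [Fintype.card_fin]
    calc (Kn : ℝ) * (γ * (C * (B ^ (L - 1) * α)) + A)
        = Kn * (C * (γ * B ^ (L - 1) * α) + A * 1) := by ring
      _ ≤ Kn * (3 * C * (γ * B ^ L * α) + A * (γ * B ^ L * α)) := by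
          gcongr
          linarith
      _ = _ := by ring
  · intro Kn x α B γ w v hα hB hγ hx hw hv hwo
    refine (norm_fderiv_weightedSum_sub_le
      (c := fun k : Fin Kn => EuclideanSpace.proj (Sum.inr (Sum.inr k)))
      (h := fun k u => hid σ Kn L r d u k (L - 1) ⟨0, hr⟩ x)
      (fun k => h.differentiable Kn k ⟨0, hr⟩ x)
      (fun k => EuclideanSpace.norm_proj_le_one _) hwo
      (fun k => (abs_output_sub_le_blockDist w v k).trans (blockDist_le_norm w v k))
      (fun k => (h.abs_sub_le Kn k ⟨0, hr⟩ x α B w v hα hB hx hw).trans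
        (mul_le_mul_of_nonneg_left (mul_le_mul_of_nonneg_left (blockDist_le_norm w v k)
          (by positivity)) hC0))
      (fun k => h.norm_fderiv_le Kn k ⟨0, hr⟩ x α B v hα hB hx hv)
      (fun k => (h.norm_fderiv_sub_le Kn k ⟨0, hr⟩ x α B w v hα hB hx hw hv).trans
        (mul_le_mul_of_nonneg_left (mul_le_mul_of_nonneg_left (blockDist_le_norm w v k)
          (by positivity)) hC0))).trans ?_
    have h1 : B ^ (2 * (L - 1)) ≤ B ^ (2 * L) := pow_le_pow_right₀ hB (by omega)
    have h2 : B ^ (L - 1) ≤ B ^ (2 * L) := pow_le_pow_right₀ hB (by omega)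
    have h3 : α ≤ α ^ 2 := le_self_pow₀ hα two_ne_zero
    rw [Fintype.card_fin]
    set T := ‖w - v‖ with hT
    have hT0 : 0 ≤ T := norm_nonneg _
    calc (Kn : ℝ) * (γ * (C * (B ^ (2 * (L - 1)) * α ^ 2 * T)) + T * (C * (B ^ (L - 1) * α))
          + C * (B ^ (L - 1) * α * T))
        = Kn * (γ * (C * (B ^ (2 * (L - 1)) * α ^ 2 * T)) + 1 * (C * (B ^ (L - 1) * α * T))
          + 1 * (C * (B ^ (L - 1) * α * T))) := by ring
      _ ≤ Kn * (γ * (C * (B ^ (2 * L) * α ^ 2 * T)) + γ * (C * (B ^ (2 * L) * α ^ 2 * T))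
          + γ * (C * (B ^ (2 * L) * α ^ 2 * T))) := by gcongr
      _ = 3 * C * (Kn * γ * B ^ (2 * L) * α ^ 2 * T) := by ring
      _ ≤ _ := by
        gcongr
        linarith

theorem cubeInd_of_mem {d : ℕ} {α : ℝ} {x : Fin d → ℝ} (hx : ∀ j, |x j| ≤ α) :
    cubeInd d α x = 1 := Set.indicator_of_mem (s := {y : Fin d → ℝ | ∀ j, |y j| ≤ α}) hx _

theorem cubeInd_of_notMem {d : ℕ} {α : ℝ} {x : Fin d → ℝ} (hx : ¬ ∀ j, |x j| ≤ α) :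
    cubeInd d α x = 0 := Set.indicator_of_notMem (s := {y : Fin d → ℝ | ∀ j, |y j| ≤ α}) hx _

theorem average_le_of_forall_le {n : ℕ} {a : Fin n → ℝ} {c : ℝ} (hc : 0 ≤ c)
    (h : ∀ i, a i ≤ c) : 1 / (n : ℝ) * ∑ i, a i ≤ c := by
  rcases n.eq_zero_or_pos with rfl | hn
  · simpa using hc
  · have hn' : (0 : ℝ) < n := Nat.cast_pos.2 hn
    rw [one_div, inv_mul_le_iff₀ hn']
    simpa using Finset.sum_le_card_nsmul Finset.univ a c fun i _ => h i

theorem average_abs_le_sqrt {n : ℕ} (a : Fin n → ℝ) :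
    1 / (n : ℝ) * ∑ i, |a i| ≤ Real.sqrt (1 / (n : ℝ) * ∑ i, a i ^ 2) := by
  refine Real.le_sqrt_of_sq_le ?_
  have h := sq_sum_le_card_mul_sum_sq (s := Finset.univ) (f := fun i => |a i|)
  simp only [sq_abs, Finset.card_univ, Fintype.card_fin] at h
  rcases n.eq_zero_or_pos with rfl | hn
  · simp
  · have hn' : (0 : ℝ) < n := Nat.cast_pos.2 hn
    rw [mul_pow]
    refine (mul_le_mul_of_nonneg_left h (by positivity)).trans_eq ?_
    field_simp

theorem average_abs_le_sqrt_empRisk (σ : ℝ → ℝ) {Kn L r d n : ℕ} (X : Fin n → Fin d → ℝ)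
    (Y : Fin n → ℝ) (α : ℝ) {c2 : ℝ} (hc2 : 0 ≤ c2) (v : EuclideanSpace ℝ (Idx Kn L r d)) :
    1 / (n : ℝ) * ∑ i, |(netF σ Kn L r d v (X i) - Y i) * cubeInd d α (X i)| ≤
      Real.sqrt (empRisk σ Kn L r d n X Y α c2 v) := by
  refine (average_abs_le_sqrt _).trans (Real.sqrt_le_sqrt ?_)
  have h : ∀ i, ((netF σ Kn L r d v (X i) - Y i) * cubeInd d α (X i)) ^ 2 =
      (netF σ Kn L r d v (X i) - Y i) ^ 2 * cubeInd d α (X i) := fun i => by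
    by_cases hx : ∀ j, |X i j| ≤ α
    · simp [cubeInd_of_mem hx]
    · simp [cubeInd_of_notMem hx]
  simp only [h, empRisk]
  exact le_add_of_nonneg_right (by positivity)

theorem fderiv_empRisk {σ : ℝ → ℝ} {Kn L r d n : ℕ}
    (hd : ∀ x : Fin d → ℝ, Differentiable ℝ fun w => netF σ Kn L r d w x)
    (X : Fin n → Fin d → ℝ) (Y : Fin n → ℝ) (α c2 : ℝ) (w : EuclideanSpace ℝ (Idx Kn L r d)) :
    fderiv ℝ (empRisk σ Kn L r d n X Y α c2) w =
      (1 / (n : ℝ)) • (∑ i, (2 * cubeInd d α (X i)) • (netF σ Kn L r d w (X i) - Y i) •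
        fderiv ℝ (fun w => netF σ Kn L r d w (X i)) w) +
      (2 * c2) • ∑ k : Fin Kn, w (Sum.inr (Sum.inr k)) •
        (EuclideanSpace.proj (Sum.inr (Sum.inr k)) :
          EuclideanSpace ℝ (Idx Kn L r d) →L[ℝ] ℝ) := by
  have h1 := HasFDerivAt.fun_sum (u := Finset.univ) fun (i : Fin n) _ =>
    ((((hd (X i) w).hasFDerivAt).sub_const (Y i)).pow 2).mul_const (cubeInd d α (X i))
  have h2 := HasFDerivAt.fun_sum (u := Finset.univ) fun (k : Fin Kn) _ =>
    ((EuclideanSpace.proj (Sum.inr (Sum.inr k)) :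
      EuclideanSpace ℝ (Idx Kn L r d) →L[ℝ] ℝ).hasFDerivAt (x := w)).pow 2
  refine ((h1.const_mul (1 / (n : ℝ))).add (h2.const_mul c2)).fderiv.trans ?_
  simp only [Finset.smul_sum, smul_smul]
  congr 1 <;> refine Finset.sum_congr rfl fun _ _ => ?_ <;> congr 1 <;>
    simp only [nsmul_eq_mul, Nat.add_one_sub_one, pow_one, PiLp.proj_apply, Nat.cast_ofNat] <;>
    ring

namespace NetBounds

variable {σ : ℝ → ℝ} {Kn L r d n : ℕ} {C α B γ c2 : ℝ}
  {w1 w2 v : EuclideanSpace ℝ (Idx Kn L r d)}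

theorem average_abs_residual_le (h : NetBounds σ L r d C) (hC : 0 ≤ C) (hc2 : 0 ≤ c2)
    (hα : 1 ≤ α) (hB : 1 ≤ B) (hγ : 1 ≤ γ) (hw : InnerWeightsLe B w2)
    (hwo : ∀ k, |w2 (Sum.inr (Sum.inr k))| ≤ γ) (X : Fin n → Fin d → ℝ) (Y : Fin n → ℝ) :
    1 / (n : ℝ) * ∑ i, |(netF σ Kn L r d w2 (X i) - Y i) * cubeInd d α (X i)| ≤
      C * (Real.sqrt Kn * γ * B ^ L * α * ‖w2 - v‖) +
        Real.sqrt (empRisk σ Kn L r d n X Y α c2 v) := by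
  refine le_trans ?_ (add_le_add (average_le_of_forall_le (n := n)
    (a := fun i => |(netF σ Kn L r d w2 (X i) - netF σ Kn L r d v (X i)) * cubeInd d α (X i)|)
    (by positivity) fun i => ?_) (average_abs_le_sqrt_empRisk σ X Y α hc2 v))
  · rw [← mul_add, ← Finset.sum_add_distrib]
    gcongr with i
    refine le_trans (le_of_eq ?_) (abs_add_le _ _)
    congr 1
    ring
  · by_cases hx : ∀ j, |X i j| ≤ α
    · simpa [cubeInd_of_mem hx] using h.abs_sub_le Kn (X i) α B γ w2 v hα hB hγ hx hw hwo
    · simp only [cubeInd_of_notMem hx, mul_zero, abs_zero]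
      positivity

theorem norm_summand_sub_le (h : NetBounds σ L r d C) (hC : 0 ≤ C)
    (hα : 1 ≤ α) (hB : 1 ≤ B) (hγ : 1 ≤ γ) (hw1 : InnerWeightsLe B w1)
    (hw2 : InnerWeightsLe B w2) (hwo1 : ∀ k, |w1 (Sum.inr (Sum.inr k))| ≤ γ)
    (x : Fin d → ℝ) (y : ℝ) :
    ‖(2 * cubeInd d α x) • (netF σ Kn L r d w1 x - y) • fderiv ℝ (fun w => netF σ Kn L r d w x) w1
      - (2 * cubeInd d α x) • (netF σ Kn L r d w2 x - y) •
        fderiv ℝ (fun w => netF σ Kn L r d w x) w2‖ ≤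
    2 * (C * (Kn * γ * B ^ (2 * L) * α ^ 2 * ‖w1 - w2‖)) *
        |(netF σ Kn L r d w2 x - y) * cubeInd d α x| +
      2 * (C * (Real.sqrt Kn * γ * B ^ L * α * ‖w1 - w2‖) * (C * (Kn * γ * B ^ L * α))) := by
  by_cases hx : ∀ j, |x j| ≤ α
  · rw [cubeInd_of_mem hx, ← smul_sub, norm_smul, mul_one, mul_one, norm_sub_rev]
    have hnet : |netF σ Kn L r d w2 x - y - (netF σ Kn L r d w1 x - y)| ≤
        C * (Real.sqrt Kn * γ * B ^ L * α * ‖w1 - w2‖) := by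
      rw [sub_sub_sub_cancel_right, abs_sub_comm]
      exact h.abs_sub_le Kn x α B γ w1 w2 hα hB hγ hx hw1 hwo1
    have hderiv := h.norm_fderiv_sub_le Kn x α B γ w1 w2 hα hB hγ hx hw1 hw2 hwo1
    rw [norm_sub_rev] at hderiv
    have := norm_smul_sub_smul_le le_rfl
      (h.norm_fderiv_le Kn x α B γ w1 hα hB hγ hx hw1 hwo1) hnet hderiv
    rw [Real.norm_two]
    linarith
  · simp only [cubeInd_of_notMem hx, mul_zero, zero_smul, sub_self, norm_zero, abs_zero, zero_add]
    positivity

theorem norm_fderiv_empRisk_sub_le (h : NetBounds σ L r d C) (hC : 0 ≤ C) (hc2 : 0 ≤ c2)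
    (hα : 1 ≤ α) (hB : 1 ≤ B) (hγ : 1 ≤ γ) (hw1 : InnerWeightsLe B w1)
    (hw2 : InnerWeightsLe B w2) (hwo1 : ∀ k, |w1 (Sum.inr (Sum.inr k))| ≤ γ)
    (hwo2 : ∀ k, |w2 (Sum.inr (Sum.inr k))| ≤ γ) (X : Fin n → Fin d → ℝ) (Y : Fin n → ℝ) :
    ‖fderiv ℝ (empRisk σ Kn L r d n X Y α c2) w1 - fderiv ℝ (empRisk σ Kn L r d n X Y α c2) w2‖ ≤
      2 * (C * (Kn * γ * B ^ (2 * L) * α ^ 2 * ‖w1 - w2‖)) *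
        (C * (Real.sqrt Kn * γ * B ^ L * α * ‖w2 - v‖) +
          Real.sqrt (empRisk σ Kn L r d n X Y α c2 v)) +
      2 * (C * (Real.sqrt Kn * γ * B ^ L * α * ‖w1 - w2‖) * (C * (Kn * γ * B ^ L * α))) +
      2 * c2 * (Real.sqrt Kn * ‖w1 - w2‖) := by
  rw [fderiv_empRisk (h.differentiable Kn), fderiv_empRisk (h.differentiable Kn),
    add_sub_add_comm, ← smul_sub, ← smul_sub, ← Finset.sum_sub_distrib, ← Finset.sum_sub_distrib]
  refine (norm_add_le _ _).trans (add_le_add ?_ ?_)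
  · rw [norm_smul, Real.norm_of_nonneg (by positivity)]
    refine (mul_le_mul_of_nonneg_left (norm_sum_le_of_le _ fun i _ =>
      h.norm_summand_sub_le hC hα hB hγ hw1 hw2 hwo1 (X i) (Y i)) (by positivity)).trans ?_
    rw [Finset.sum_add_distrib, mul_add, ← Finset.mul_sum, mul_left_comm]
    exact add_le_add (mul_le_mul_of_nonneg_left
      (h.average_abs_residual_le hC hc2 hα hB hγ hw2 hwo2 X Y) (by positivity))
      (average_le_of_forall_le (by positivity) fun _ => le_rfl)
  · rw [norm_smul, Real.norm_of_nonneg (by positivity)]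
    refine mul_le_mul_of_nonneg_left ?_ (by positivity)
    refine (norm_sum_le_of_le (n := blockDist w1 w2) _ fun k _ => ?_).trans
      (sum_blockDist_le w1 w2)
    rw [← sub_smul, norm_smul, Real.norm_eq_abs]
    simpa using mul_le_mul (abs_output_sub_le_blockDist w1 w2 k)
      (EuclideanSpace.norm_proj_le_one (Sum.inr (Sum.inr k))) (norm_nonneg _)
      (blockDist_nonneg w1 w2 k)

end NetBounds

theorem exists_activationBounds {σ : ℝ → ℝ} (hσdiff : Differentiable ℝ σ)
    (hσbdd : ∃ M, ∀ x, |σ x| ≤ M) (hσ'bdd : ∃ M, ∀ x, |deriv σ x| ≤ M)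
    (hσ'lip : ∃ M : NNReal, LipschitzWith M (deriv σ)) : ∃ A, ActivationBounds σ A := by
  obtain ⟨M₀, h₀⟩ := hσbdd
  obtain ⟨M₁, h₁⟩ := hσ'bdd
  obtain ⟨M₂, h₂⟩ := hσ'lip
  refine ⟨max (max M₀ M₁) (max M₂ 1), by simp, hσdiff, fun t => ?_, fun t => ?_, fun s t => ?_⟩
  · exact (h₀ t).trans (by simp)
  · exact (h₁ t).trans (by simp)
  · have := h₂.dist_le_mul s t
    rw [Real.dist_eq, Real.dist_eq] at this
    exact this.trans (mul_le_mul_of_nonneg_right (by simp) (abs_nonneg _))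


/-- Lemma 3: Lipschitz-type bound for the gradient of the regularized empirical L₂ risk. -/
theorem gradient_lipschitz_bound
    (d r L : ℕ) (hd : 0 < d) (hL : 2 ≤ L) (hr : 2 * d ≤ r)
    (σ : ℝ → ℝ) (hσdiff : Differentiable ℝ σ)
    (hσbdd : ∃ M, ∀ x, |σ x| ≤ M) (hσ'bdd : ∃ M, ∀ x, |deriv σ x| ≤ M)
    (hσ'lip : ∃ M : NNReal, LipschitzWith M (deriv σ))
    (c2 : ℝ) (hc2 : 0 < c2) :
    ∃ c7 : ℝ, 0 < c7 ∧
      ∀ (n Kn : ℕ) (X : Fin n → Fin d → ℝ) (Y : Fin n → ℝ)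
        (αn tn Ln γ B : ℝ) (w1 w2 v : EuclideanSpace ℝ (Idx Kn L r d)),
        1 ≤ αn → 0 < Ln → Ln ≤ tn → 1 ≤ γ → 1 ≤ B →
        (∀ k : Fin Kn,
          max |w1 (Sum.inr (Sum.inr k))| |w2 (Sum.inr (Sum.inr k))| ≤ γ) →
        (∀ (k : Fin Kn) (l : Fin (L - 1)) (i : Fin r) (j : Fin (r + 1)),
          max |w1 (Sum.inr (Sum.inl (k, l, i, j)))| |w2 (Sum.inr (Sum.inl (k, l, i, j)))| ≤ B) →
        ‖w2 - v‖ ^ 2 ≤ 8 * (tn / Ln) * max (empRisk σ Kn L r d n X Y αn c2 v) 1 →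
        ‖gradient (empRisk σ Kn L r d n X Y αn c2) w1 -
            gradient (empRisk σ Kn L r d n X Y αn c2) w2‖ ≤
          c7 * max (Real.sqrt (empRisk σ Kn L r d n X Y αn c2 v)) 1 * γ ^ 2 * B ^ (3 * L) *
            αn ^ 3 * (Kn : ℝ) ^ (3 / 2 : ℝ) * Real.sqrt (tn / Ln) * ‖w1 - w2‖ := by
  obtain ⟨A, hσ⟩ := exists_activationBounds hσdiff hσbdd hσ'bdd hσ'lip
  obtain ⟨C, hC, h⟩ := hσ.exists_netBounds (L := L) d (show 0 < r by omega)
  have hC0 : 0 ≤ C := zero_le_one.trans hC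
  refine ⟨2 * C * (3 * C + 1) + 2 * C ^ 2 + 2 * c2, by positivity, ?_⟩
  intro n Kn X Y α tn Ln γ B w1 w2 v hα hLn htn hγ hB hout hinner hv
  rw [gradient, gradient, ← map_sub, LinearIsometryEquiv.norm_map]
  refine (h.norm_fderiv_empRisk_sub_le (v := v) hC0 hc2.le hα hB hγ
    (fun k l i j => (le_max_left _ _).trans (hinner k l i j))
    (fun k l i j => (le_max_right _ _).trans (hinner k l i j))
    (fun k => (le_max_left _ _).trans (hout k))
    (fun k => (le_max_right _ _).trans (hout k)) X Y).trans ?_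
  set F := empRisk σ Kn L r d n X Y α c2 v
  set T := ‖w1 - w2‖
  set m := max (Real.sqrt F) 1
  set q := Real.sqrt (tn / Ln)
  set s := Real.sqrt Kn
  have hT : 0 ≤ T := norm_nonneg _
  have hm : 1 ≤ m := le_max_right _ _
  have hq : 1 ≤ q := Real.one_le_sqrt.2 ((one_le_div hLn).2 htn)
  have hs0 : 0 ≤ s := Real.sqrt_nonneg _
  have hs : (Kn : ℝ) = s ^ 2 := (Real.sq_sqrt (Nat.cast_nonneg _)).symm
  have hrpow : (Kn : ℝ) ^ (3 / 2 : ℝ) = s ^ 3 := by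
    rw [hs, ← Real.rpow_natCast s 2, ← Real.rpow_mul hs0, ← Real.rpow_natCast s 3]
    norm_num
  have hwv : ‖w2 - v‖ ≤ 3 * (q * m) := by
    refine abs_le_of_sq_le_sq' ?_ (by positivity) |>.2
    have hF : max F 1 ≤ m ^ 2 := by
      refine max_le ?_ (one_le_pow₀ hm)
      rcases le_total 0 F with hF | hF
      · rw [← Real.sq_sqrt hF]
        gcongr
        exact le_max_left _ _
      · exact hF.trans (sq_nonneg _)
    have hq2 : q ^ 2 = tn / Ln := Real.sq_sqrt (div_nonneg (hLn.le.trans htn) hLn.le)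
    calc ‖w2 - v‖ ^ 2 ≤ 8 * q ^ 2 * max F 1 := by rw [hq2]; exact hv
      _ ≤ 9 * q ^ 2 * m ^ 2 := by gcongr; norm_num
      _ = _ := by ring
  have hsplit : s = 0 ∨ 1 ≤ s := by
    rcases Kn.eq_zero_or_pos with h0 | h0
    · exact Or.inl (by simp [s, h0])
    · exact Or.inr (Real.one_le_sqrt.2 (by exact_mod_cast h0))
  rw [hrpow, hs]
  rcases hsplit with h0 | h1
  · simp [h0]
  have hb : 1 ≤ B ^ L := one_le_pow₀ hB
  have hB2 : B ^ (2 * L) = (B ^ L) ^ 2 := by ring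
  have hB3 : B ^ (3 * L) = (B ^ L) ^ 3 := by ring
  rw [hB2, hB3]
  generalize B ^ L = b at hb ⊢
  have hres : C * (s * γ * b * α * ‖w2 - v‖) + Real.sqrt F ≤
      (3 * C + 1) * (s * γ * b * α * (q * m)) := by
    have hone : 1 ≤ s * γ * b * α * q := one_le_mul_of_one_le_of_one_le
      (one_le_mul_of_one_le_of_one_le (one_le_mul_of_one_le_of_one_le
        (one_le_mul_of_one_le_of_one_le h1 hγ) hb) hα) hq
    calc C * (s * γ * b * α * ‖w2 - v‖) + Real.sqrt F
        ≤ C * (s * γ * b * α * (3 * (q * m))) + 1 * m := by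
          gcongr
          rw [one_mul]
          exact le_max_left _ _
      _ ≤ C * (s * γ * b * α * (3 * (q * m))) + s * γ * b * α * q * m := by gcongr
      _ = _ := by ring
  have hfirst : 2 * (C * (s ^ 2 * γ * b ^ 2 * α ^ 2 * T)) *
      (C * (s * γ * b * α * ‖w2 - v‖) + Real.sqrt F) ≤
      2 * C * (3 * C + 1) * (m * γ ^ 2 * b ^ 3 * α ^ 3 * s ^ 3 * q * T) :=
    (mul_le_mul_of_nonneg_left hres (by positivity)).trans_eq (by ring)
  have hsecond : 2 * (C * (s * γ * b * α * T) * (C * (s ^ 2 * γ * b * α))) ≤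
      2 * C ^ 2 * (m * γ ^ 2 * b ^ 3 * α ^ 3 * s ^ 3 * q * T) := by
    calc 2 * (C * (s * γ * b * α * T) * (C * (s ^ 2 * γ * b * α)))
        = 2 * C ^ 2 * (1 * γ ^ 2 * b ^ 2 * α ^ 2 * s ^ 3 * 1 * T) := by ring
      _ ≤ _ := by
        gcongr
        · norm_num
        · norm_num
  have hthird : 2 * c2 * (s * T) ≤
      2 * c2 * (m * γ ^ 2 * b ^ 3 * α ^ 3 * s ^ 3 * q * T) := by
    calc 2 * c2 * (s * T) = 2 * c2 * (1 * 1 * 1 * 1 * s * 1 * T) := by ring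
      _ ≤ _ := by
        gcongr
        · exact one_le_pow₀ hγ
        · exact one_le_pow₀ hb
        · exact one_le_pow₀ hα
        · exact le_self_pow₀ h1 three_ne_zero
  calc _ ≤ _ := add_le_add (add_le_add hfirst hsecond) hthird
    _ = _ := by ring

end
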